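/- Let d ≥ 1 and let V, F : ℝ^d → ℝ be twice continuously differentiable. Let a ∈ ℝ^d with ∇V(a) = 0, let β₀, β₂ > 0 and β₁ ≥ 0 satisfy ⟨(∇²V(a + x) + ∇²F(a − y + x))v, v⟩ ≥ (β₀ − 2β₁|x| + 3β₂|x|²)|v|² for all x, y, v ∈ ℝ^d, and let α₁, α₂ ≥ 0 satisfy |∇F(z)| ≤ α₁ + α₂|z| for all z ∈ ℝ^d. Then for every probability measure μ on ℝ^d with ∫|y − a| dμ(y) < ∞ and every x ∈ ℝ^d: ⟨∇V(x + a) + ∫ ∇F(x + a − y) dμ(y), x⟩ ≥ (β₀ − β₁|x| + β₂|x|²)|x|² − (α₁ + α₂ ∫|y − a| dμ(y)) |x|. -/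

import Mathlib

open MeasureTheory RealInnerProductSpace

section Gradient

variable {E : Type*} [NormedAddCommGroup E] [InnerProductSpace ℝ E] [CompleteSpace E]

theorem inner_gradient_left_eq_fderiv (G : E → ℝ) (z v : E) :
    ⟪gradient G z, v⟫ = fderiv ℝ G z v := by
  simp [gradient]

theorem ContDiff.continuous_gradient {G : E → ℝ} (hG : ContDiff ℝ 1 G) :
    Continuous (gradient G) :=
  (InnerProductSpace.toDual ℝ E).symm.continuous.comp (hG.continuous_fderiv one_ne_zero)

/-- The derivative of the directional derivative of `G` along a line is the second derivative. -/
theorem ContDiff.hasDerivAt_inner_gradient_line {G : E → ℝ} (hG : ContDiff ℝ 2 G)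
    (c x : E) (t : ℝ) :
    HasDerivAt (fun s : ℝ => ⟪gradient G (c + s • x), x⟫)
      (iteratedFDeriv ℝ 2 G (c + t • x) ![x, x]) t := by
  have hline : HasDerivAt (fun s : ℝ => c + s • x) x t := by
    simpa using ((hasDerivAt_id t).smul_const x).const_add c
  have hfderiv : DifferentiableAt ℝ (fderiv ℝ G) (c + t • x) :=
    (hG.fderiv_right (m := 1) (by norm_num)).differentiable one_ne_zero _
  have h : HasDerivAt (fun s : ℝ => fderiv ℝ G (c + s • x))
      (fderiv ℝ (fderiv ℝ G) (c + t • x) x) t :=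
    hfderiv.hasFDerivAt.comp_hasDerivAt t hline
  simp only [inner_gradient_left_eq_fderiv, iteratedFDeriv_two_apply]
  simpa using h.clm_apply (hasDerivAt_const t x)

/-- Integrating a quadratic lower bound on the sum of two Hessians along a segment. -/
theorem inner_gradient_add_inner_gradient_ge_of_hessian_ge {V F : E → ℝ}
    (hV : ContDiff ℝ 2 V) (hF : ContDiff ℝ 2 F) {β₀ β₁ β₂ : ℝ} (a b x : E)
    (hHess : ∀ u v : E, (β₀ - 2 * β₁ * ‖u‖ + 3 * β₂ * ‖u‖ ^ 2) * ‖v‖ ^ 2 ≤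
      iteratedFDeriv ℝ 2 V (a + u) ![v, v] + iteratedFDeriv ℝ 2 F (b + u) ![v, v]) :
    ⟪gradient V a, x⟫ + ⟪gradient F b, x⟫ + (β₀ - β₁ * ‖x‖ + β₂ * ‖x‖ ^ 2) * ‖x‖ ^ 2 ≤
      ⟪gradient V (a + x), x⟫ + ⟪gradient F (b + x), x⟫ := by
  let φ : ℝ → ℝ := fun t => ⟪gradient V (a + t • x), x⟫ + ⟪gradient F (b + t • x), x⟫
    - (β₀ * t - β₁ * ‖x‖ * t ^ 2 + β₂ * ‖x‖ ^ 2 * t ^ 3) * ‖x‖ ^ 2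
  have hφ (t : ℝ) : HasDerivAt φ
      (iteratedFDeriv ℝ 2 V (a + t • x) ![x, x] + iteratedFDeriv ℝ 2 F (b + t • x) ![x, x]
        - (β₀ - 2 * β₁ * (t * ‖x‖) + 3 * β₂ * (t * ‖x‖) ^ 2) * ‖x‖ ^ 2) t := by
    have hp := ((((hasDerivAt_id t).const_mul β₀).sub
      ((hasDerivAt_pow 2 t).const_mul (β₁ * ‖x‖))).add
      ((hasDerivAt_pow 3 t).const_mul (β₂ * ‖x‖ ^ 2))).mul_const (‖x‖ ^ 2)
    refine (((hV.hasDerivAt_inner_gradient_line a x t).add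
      (hF.hasDerivAt_inner_gradient_line b x t)).sub hp).congr_deriv ?_
    simp only [Nat.cast_ofNat, Nat.reduceSub]
    ring
  have hmono : MonotoneOn φ (Set.Icc 0 1) := by
    refine monotoneOn_of_hasDerivWithinAt_nonneg (convex_Icc 0 1)
      (fun t _ => (hφ t).continuousAt.continuousWithinAt)
      (fun t _ => (hφ t).hasDerivWithinAt) fun t ht => ?_
    rw [interior_Icc] at ht
    have h := hHess (t • x) x
    rw [norm_smul, Real.norm_of_nonneg ht.1.le] at h
    linarith
  have h : φ 0 ≤ φ 1 := hmono (by simp) (by simp) zero_le_one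
  simp only [φ, zero_smul, one_smul, add_zero] at h
  linarith

end Gradient

/-- Drift estimate around the critical point `a` proved inside Corollary 2.4 for
the McKean–Vlasov drift `b(x, μ) = −∇V(x) − (∇F ∗ μ)(x)`. -/
theorem drift_estimate_at_critical_point (d : ℕ) (hd : 1 ≤ d)
    (V F : EuclideanSpace ℝ (Fin d) → ℝ) (hV : ContDiff ℝ 2 V) (hF : ContDiff ℝ 2 F)
    (a : EuclideanSpace ℝ (Fin d)) (ha : gradient V a = 0)
    (β₀ β₁ β₂ α₁ α₂ : ℝ) (hβ₀ : 0 < β₀) (hβ₂ : 0 < β₂) (hβ₁ : 0 ≤ β₁)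
    (hα₁ : 0 ≤ α₁) (hα₂ : 0 ≤ α₂)
    (hHess : ∀ x y v : EuclideanSpace ℝ (Fin d),
      (β₀ - 2 * β₁ * ‖x‖ + 3 * β₂ * ‖x‖ ^ 2) * ‖v‖ ^ 2 ≤
        iteratedFDeriv ℝ 2 V (a + x) ![v, v] + iteratedFDeriv ℝ 2 F (a - y + x) ![v, v])
    (hF1 : ∀ z : EuclideanSpace ℝ (Fin d), ‖gradient F z‖ ≤ α₁ + α₂ * ‖z‖)
    (μ : Measure (EuclideanSpace ℝ (Fin d))) [IsProbabilityMeasure μ]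
    (hμ : Integrable (fun y => ‖y - a‖) μ) (x : EuclideanSpace ℝ (Fin d)) :
    (β₀ - β₁ * ‖x‖ + β₂ * ‖x‖ ^ 2) * ‖x‖ ^ 2
        - (α₁ + α₂ * ∫ y, ‖y - a‖ ∂μ) * ‖x‖ ≤
      ⟪gradient V (x + a) + ∫ y, gradient F (x + a - y) ∂μ, x⟫ := by
  have hbound : Integrable (fun y => α₁ + α₂ * (‖x‖ + ‖y - a‖)) μ :=
    (integrable_const _).add (((integrable_const _).add hμ).const_mul _)
  have hint : Integrable (fun y => gradient F (x + a - y)) μ := by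
    refine hbound.mono'
      ((hF.of_le one_le_two).continuous_gradient.comp
        (continuous_const.sub continuous_id)).aestronglyMeasurable
      (Filter.Eventually.of_forall fun y => (hF1 _).trans ?_)
    have : ‖x + a - y‖ ≤ ‖x‖ + ‖y - a‖ := by
      rw [show x + a - y = x - (y - a) by abel]
      exact norm_sub_le _ _
    gcongr
  have hpoint (y : EuclideanSpace ℝ (Fin d)) :
      (β₀ - β₁ * ‖x‖ + β₂ * ‖x‖ ^ 2) * ‖x‖ ^ 2 - (α₁ + α₂ * ‖y - a‖) * ‖x‖ ≤
        ⟪gradient V (x + a), x⟫ + ⟪x, gradient F (x + a - y)⟫ := by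
    have h := inner_gradient_add_inner_gradient_ge_of_hessian_ge hV hF a (a - y) x
      fun u v => hHess u y v
    rw [ha, inner_zero_left, add_comm a x, show a - y + x = x + a - y by abel] at h
    have hF0 : -((α₁ + α₂ * ‖y - a‖) * ‖x‖) ≤ ⟪gradient F (a - y), x⟫ := by
      refine (neg_le_neg ?_).trans (neg_le_of_abs_le (abs_real_inner_le_norm _ _))
      rw [norm_sub_rev y a]
      exact mul_le_mul_of_nonneg_right (hF1 _) (norm_nonneg x)
    rw [real_inner_comm (gradient F (x + a - y)) x]
    linarith
  have hlin : Integrable (fun y => (α₁ + α₂ * ‖y - a‖) * ‖x‖) μ :=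
    ((integrable_const _).add (hμ.const_mul _)).mul_const _
  have h := integral_mono ((integrable_const _).sub hlin)
    ((integrable_const _).add (hint.const_inner x)) hpoint
  simp only [Pi.add_apply, Pi.sub_apply] at h
  rw [integral_sub (integrable_const _) hlin, integral_mul_const (‖x‖),
    integral_add (integrable_const _) (hμ.const_mul _), integral_const_mul α₂,
    integral_add (integrable_const _) (hint.const_inner x), integral_inner hint] at h
  simp only [integral_const, probReal_univ, one_smul] at h
  rwa [inner_add_left, real_inner_comm x (∫ y, gradient F (x + a - y) ∂μ)]
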